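/- arXiv:2501.16876 — 3 statements merged into one kernel-verified Lean document; each statement's English description precedes it below -/
import Mathlib

section
/- Let Ω be a nonempty closed subset of the Riemann sphere ℂ ∪ {∞}. An n×n pencil (S,T) belongs to the closure of S_tri(Ω,n) if and only if both S and T are upper triangular and, for every index i, the pair of diagonal entries (S_{ii}, T_{ii}) belongs to the closure of S(Ω,1) in ℂ². -/
open Matrix

/-- The determinant `det(A + X·B)` of the pencil `P = (A,B)`, as a polynomial in `X`. -/
noncomputable def pencilPoly {n : ℕ}
    (P : Matrix (Fin n) (Fin n) ℂ × Matrix (Fin n) (Fin n) ℂ) : Polynomial ℂ :=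
  (P.1.map Polynomial.C + (Polynomial.X : Polynomial ℂ) • P.2.map Polynomial.C).det

/-- `S(Ω,n)`: the set of regular `n×n` pencils all of whose eigenvalues (finite eigenvalues
are the roots of `det(A + X·B)`; `∞` is an eigenvalue iff `det B = 0`) belong to `Ω`,
a subset of the Riemann sphere `ℂ ∪ {∞}`. -/
def SOmega (Ω : Set (OnePoint ℂ)) (n : ℕ) :
    Set (Matrix (Fin n) (Fin n) ℂ × Matrix (Fin n) (Fin n) ℂ) :=
  {P | pencilPoly P ≠ 0 ∧
    (∀ z : ℂ, (pencilPoly P).IsRoot z → (z : OnePoint ℂ) ∈ Ω) ∧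
    (P.2.det = 0 → (OnePoint.infty : OnePoint ℂ) ∈ Ω)}

/-- `S_tri(Ω,n)`: the pencils of `S(Ω,n)` with both coefficients upper triangular. -/
def Stri (Ω : Set (OnePoint ℂ)) (n : ℕ) :
    Set (Matrix (Fin n) (Fin n) ℂ × Matrix (Fin n) (Fin n) ℂ) :=
  {P ∈ SOmega Ω n |
    (∀ i j : Fin n, j < i → P.1 i j = 0) ∧ (∀ i j : Fin n, j < i → P.2 i j = 0)}

/-- `S(Ω,1)` for `1×1` pencils, identified with pairs `(a,b) ∈ ℂ²`. -/
def SOmega1 (Ω : Set (OnePoint ℂ)) : Set (ℂ × ℂ) :=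
  {p | p ≠ (0, 0) ∧ (p.2 ≠ 0 → ((-p.1 / p.2 : ℂ) : OnePoint ℂ) ∈ Ω) ∧
    (p.2 = 0 → (OnePoint.infty : OnePoint ℂ) ∈ Ω)}

/-- The norm `‖(A,B)‖ = (‖A‖_F² + ‖B‖_F²)^{1/2}` of a pencil. -/
noncomputable def pencilNorm {n : ℕ}
    (P : Matrix (Fin n) (Fin n) ℂ × Matrix (Fin n) (Fin n) ℂ) : ℝ :=
  Real.sqrt (∑ i, ∑ j, (‖P.1 i j‖ ^ 2 + ‖P.2 i j‖ ^ 2))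

/-- Euclidean distance on `ℂ²`. -/
noncomputable def distC2 (p q : ℂ × ℂ) : ℝ :=
  Real.sqrt (‖p.1 - q.1‖ ^ 2 + ‖p.2 - q.2‖ ^ 2)

/-- The determinant of a pencil of upper triangular matrices is the product of its diagonal. -/
theorem pencilPoly_of_upperTriangular {n : ℕ}
    {P : Matrix (Fin n) (Fin n) ℂ × Matrix (Fin n) (Fin n) ℂ}
    (hA : ∀ i j : Fin n, j < i → P.1 i j = 0) (hB : ∀ i j : Fin n, j < i → P.2 i j = 0) :
    pencilPoly P =
      ∏ i, (Polynomial.C (P.1 i i) + Polynomial.X * Polynomial.C (P.2 i i)) := by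
  rw [pencilPoly, Matrix.det_of_isUpperTriangular]
  · simp
  · intro i j hij
    have hij' : j < i := hij
    simp [hA i j hij', hB i j hij']

/-- An upper triangular pencil lies in `S(Ω,n)` iff its diagonal pairs lie in `S(Ω,1)`. -/
theorem mem_Stri_iff {n : ℕ} (Ω : Set (OnePoint ℂ))
    (P : Matrix (Fin n) (Fin n) ℂ × Matrix (Fin n) (Fin n) ℂ) :
    P ∈ Stri Ω n ↔
      (∀ i j : Fin n, j < i → P.1 i j = 0) ∧ (∀ i j : Fin n, j < i → P.2 i j = 0) ∧
      ∀ i : Fin n, (P.1 i i, P.2 i i) ∈ SOmega1 Ω := by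
  have key : ∀ (_ : ∀ i j : Fin n, j < i → P.1 i j = 0)
      (_ : ∀ i j : Fin n, j < i → P.2 i j = 0),
      P ∈ SOmega Ω n ↔ ∀ i : Fin n, (P.1 i i, P.2 i i) ∈ SOmega1 Ω := by
    intro hA hB
    have hdet : P.2.det = ∏ i, P.2 i i :=
      Matrix.det_of_isUpperTriangular fun i j hij => hB i j hij
    have hpoly := pencilPoly_of_upperTriangular hA hB
    have hfactor : ∀ i, Polynomial.C (P.1 i i) + Polynomial.X * Polynomial.C (P.2 i i) = 0 ↔
        P.1 i i = 0 ∧ P.2 i i = 0 := by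
      intro i
      constructor
      · intro h
        have h0 := congrArg (Polynomial.coeff · 0) h
        have h1 := congrArg (Polynomial.coeff · 1) h
        simp [Polynomial.coeff_C] at h0 h1
        exact ⟨h0, h1⟩
      · rintro ⟨h0, h1⟩
        simp [h0, h1]
    have hroot : ∀ z, (pencilPoly P).IsRoot z ↔ ∃ i, P.1 i i + z * P.2 i i = 0 := by
      intro z
      simp [hpoly, Polynomial.IsRoot, Polynomial.eval_prod, Finset.prod_eq_zero_iff, mul_comm z]
    have hzero : pencilPoly P ≠ 0 ↔ ∀ i, ¬ (P.1 i i = 0 ∧ P.2 i i = 0) := by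
      simp only [hpoly, Finset.prod_ne_zero_iff, Finset.mem_univ, forall_const, ne_eq, hfactor]
    simp only [SOmega, SOmega1, Set.mem_ofPred_eq, hroot, hzero, hdet, Finset.prod_eq_zero_iff,
      Finset.mem_univ, true_and, ne_eq, Prod.mk.injEq]
    constructor
    · rintro ⟨h1, h2, h3⟩ i
      refine ⟨h1 i, fun hb => h2 _ ⟨i, ?_⟩, fun hb => h3 ⟨i, hb⟩⟩
      field_simp
      ring
    · intro h
      refine ⟨fun i => (h i).1, ?_, ?_⟩
      · rintro z ⟨i, hi⟩
        have hb : P.2 i i ≠ 0 := fun hb => (h i).1 ⟨by simpa [hb] using hi, hb⟩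
        have hz : z = -P.1 i i / P.2 i i := by
          rw [eq_div_iff hb]
          linear_combination hi
        exact hz ▸ (h i).2.1 hb
      · rintro ⟨i, hi⟩
        exact (h i).2.2 hi
  constructor
  · rintro ⟨hS, hA, hB⟩
    exact ⟨hA, hB, (key hA hB).1 hS⟩
  · rintro ⟨hA, hB, hS⟩
    exact ⟨(key hA hB).2 hS, hA, hB⟩

/-- a pencil `(S,T)` belongs to the closure of `S_tri(Ω,n)` iff both
coefficients are upper triangular and every pair of diagonal entries `(S_{ii}, T_{ii})`
belongs to the closure of `S(Ω,1)` in `ℂ²`. -/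
theorem mem_closure_Stri_iff {n : ℕ} (Ω : Set (OnePoint ℂ))
    (hclosed : IsClosed Ω) (hne : Ω.Nonempty)
    (P : Matrix (Fin n) (Fin n) ℂ × Matrix (Fin n) (Fin n) ℂ) :
    P ∈ closure (Stri Ω n) ↔
      (∀ i j : Fin n, j < i → P.1 i j = 0) ∧ (∀ i j : Fin n, j < i → P.2 i j = 0) ∧
      ∀ i : Fin n, (P.1 i i, P.2 i i) ∈ closure (SOmega1 Ω) := by
  constructor
  · intro hP
    refine ⟨fun i j hij => ?_, fun i j hij => ?_, fun i => ?_⟩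
    · have hc : IsClosed {Q : Matrix (Fin n) (Fin n) ℂ × Matrix (Fin n) (Fin n) ℂ |
          Q.1 i j = 0} := isClosed_eq (by fun_prop) continuous_const
      exact closure_minimal (fun Q hQ => ((mem_Stri_iff Ω Q).1 hQ).1 i j hij) hc hP
    · have hc : IsClosed {Q : Matrix (Fin n) (Fin n) ℂ × Matrix (Fin n) (Fin n) ℂ |
          Q.2 i j = 0} := isClosed_eq (by fun_prop) continuous_const
      exact closure_minimal (fun Q hQ => ((mem_Stri_iff Ω Q).1 hQ).2.1 i j hij) hc hP
    · have hf : Continuous fun Q : Matrix (Fin n) (Fin n) ℂ × Matrix (Fin n) (Fin n) ℂ =>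
          (Q.1 i i, Q.2 i i) := by fun_prop
      exact map_mem_closure (f := fun Q : Matrix (Fin n) (Fin n) ℂ × Matrix (Fin n) (Fin n) ℂ =>
        (Q.1 i i, Q.2 i i)) hf hP fun Q hQ => ((mem_Stri_iff Ω Q).1 hQ).2.2 i
  · rintro ⟨hA, hB, hd⟩
    let F : (Fin n → ℂ × ℂ) → Matrix (Fin n) (Fin n) ℂ × Matrix (Fin n) (Fin n) ℂ :=
      fun d => (Matrix.of fun i j => if i = j then (d i).1 else P.1 i j,
        Matrix.of fun i j => if i = j then (d i).2 else P.2 i j)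
    have hF : Continuous F := by
      refine Continuous.prodMk (continuous_matrix fun i j => ?_)
        (continuous_matrix fun i j => ?_)
      · by_cases h : i = j <;> simp only [Matrix.of_apply, h, if_true, if_false] <;> fun_prop
      · by_cases h : i = j <;> simp only [Matrix.of_apply, h, if_true, if_false] <;> fun_prop
    have hFP : F (fun i => (P.1 i i, P.2 i i)) = P := by
      refine Prod.ext ?_ ?_ <;> ext i j <;> by_cases h : i = j <;> simp [F, h]
    have hdiag : (fun i => (P.1 i i, P.2 i i)) ∈
        closure (Set.univ.pi fun _ : Fin n => SOmega1 Ω) := by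
      rw [closure_pi_set]
      exact fun i _ => hd i
    rw [← hFP]
    refine map_mem_closure hF hdiag fun d hmem => (mem_Stri_iff Ω _).2 ⟨?_, ?_, fun i => ?_⟩
    · intro i j hij
      simp [F, hij.ne', hA i j hij]
    · intro i j hij
      simp [F, hij.ne', hB i j hij]
    · simpa [F] using hmem i (Set.mem_univ i)
end

section
/- Let Ω be a nonempty closed subset of the Riemann sphere ℂ ∪ {∞}, let (A,B) be an n×n pencil, and let f(Q,Z) = ‖(QAZ, QBZ) − T(QAZ, QBZ)‖² for (Q,Z) ∈ U(n) × U(n). Then the squared distance from (A,B) to the closure of S(Ω,n) equals the infimum of f(Q,Z) over all (Q,Z) ∈ U(n) × U(n): inf_{(S,T') ∈ closure S(Ω,n)} ‖(A,B) − (S,T')‖² = inf_{(Q,Z) ∈ U(n)×U(n)} f(Q,Z). -/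
open Matrix

/-- The operator `T` from Proposition 3.4: keep the strictly upper triangular part, project
each diagonal entry onto the closure of `S(Ω,1)` via `p_Ω`, zero out the lower part. -/
noncomputable def Tproj {n : ℕ} (pΩ : ℂ × ℂ → ℂ × ℂ)
    (P : Matrix (Fin n) (Fin n) ℂ × Matrix (Fin n) (Fin n) ℂ) :
    Matrix (Fin n) (Fin n) ℂ × Matrix (Fin n) (Fin n) ℂ :=
  (Matrix.of fun i j =>
      if i < j then P.1 i j else if i = j then (pΩ (P.1 i i, P.2 i i)).1 else 0,
   Matrix.of fun i j =>
      if i < j then P.2 i j else if i = j then (pΩ (P.1 i i, P.2 i i)).2 else 0)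

universe u

/-- Two linear maps between nonzero spaces of the same dimension map some line into a common
line. -/
theorem exists_ne_zero_mem_span_singleton {E F : Type*}
    [AddCommGroup E] [Module ℂ E] [FiniteDimensional ℂ E] [Nontrivial E]
    [AddCommGroup F] [Module ℂ F] [FiniteDimensional ℂ F] [Nontrivial F]
    (hEF : Module.finrank ℂ F = Module.finrank ℂ E) (S T : F →ₗ[ℂ] E) :
    ∃ v : F, v ≠ 0 ∧ ∃ w : E, w ≠ 0 ∧
      S v ∈ Submodule.span ℂ {w} ∧ T v ∈ Submodule.span ℂ {w} := by
  by_cases hT : Function.Injective T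
  · let e : F ≃ₗ[ℂ] E := T.linearEquivOfInjective hT hEF
    obtain ⟨μ, hμ⟩ := Module.End.exists_eigenvalue (e.symm.toLinearMap ∘ₗ S)
    obtain ⟨v, hv⟩ := hμ.exists_hasEigenvector
    have hev : e v = T v := rfl
    have hSv : S v = μ • T v := by
      have h := congrArg e hv.apply_eq_smul
      simpa [hev] using h
    refine ⟨v, hv.2, T v, ?_, ?_, Submodule.mem_span_singleton_self _⟩
    · rw [← hev]
      simpa using hv.2
    · rw [hSv]
      exact Submodule.smul_mem _ _ (Submodule.mem_span_singleton_self _)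
  · rw [injective_iff_map_eq_zero] at hT
    push Not at hT
    obtain ⟨v, hv, hv0⟩ := hT
    by_cases hSv : S v = 0
    · obtain ⟨w, hw⟩ := exists_ne (0 : E)
      exact ⟨v, hv0, w, hw, by simp [hSv], by simp [hv]⟩
    · exact ⟨v, hv0, S v, hSv, Submodule.mem_span_singleton_self _, by simp [hv]⟩

/-- Appending a unit vector orthogonal to an orthonormal family of the complement of its line. -/
theorem orthonormal_snoc {E : Type*} [NormedAddCommGroup E] [InnerProductSpace ℂ E]
    {n : ℕ} {w : E} (hw : w ≠ 0)
    {b : Fin n → (Submodule.span ℂ {w})ᗮ} (hb : Orthonormal ℂ b) :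
    Orthonormal ℂ (Fin.snoc (fun i => (b i : E)) ((‖w‖⁻¹ : ℂ) • w) : Fin (n + 1) → E) := by
  have horth : ∀ i, inner ℂ w (b i : E) = 0 := fun i =>
    Submodule.mem_orthogonal_singleton_iff_inner_right.1 (b i).2
  have horth' : ∀ i, inner ℂ (b i : E) w = 0 := fun i =>
    Submodule.mem_orthogonal_singleton_iff_inner_left.1 (b i).2
  rw [orthonormal_iff_ite] at hb ⊢
  intro i j
  refine Fin.lastCases ?_ (fun i => ?_) i <;> refine Fin.lastCases ?_ (fun j => ?_) j
  · have : inner ℂ ((‖w‖⁻¹ : ℂ) • w) ((‖w‖⁻¹ : ℂ) • w) = 1 := by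
      rw [inner_self_eq_norm_sq_to_K, norm_smul]
      simp [hw]
    simpa using this
  · simp [inner_smul_left, horth, (Fin.castSucc_lt_last j).ne']
  · simp [inner_smul_right, horth', (Fin.castSucc_lt_last i).ne]
  · simpa using hb i j

/-- **Generalized Schur decomposition**: two linear maps between inner product spaces of the same
dimension are simultaneously upper triangular in suitable orthonormal families. -/
theorem exists_orthonormal_triangular (n : ℕ) : ∀ (E F : Type u)
    [NormedAddCommGroup E] [InnerProductSpace ℂ E] [FiniteDimensional ℂ E]
    [NormedAddCommGroup F] [InnerProductSpace ℂ F] [FiniteDimensional ℂ F],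
    Module.finrank ℂ E = n → Module.finrank ℂ F = n → ∀ S T : E →ₗ[ℂ] F,
    ∃ b : Fin n → E, ∃ c : Fin n → F, Orthonormal ℂ b ∧ Orthonormal ℂ c ∧
      ∀ i j, j < i → inner ℂ (c i) (S (b j)) = 0 ∧ inner ℂ (c i) (T (b j)) = 0 := by
  induction n with
  | zero =>
    intro E F _ _ _ _ _ _ _ _ S T
    exact ⟨Fin.elim0, Fin.elim0, by simp [Orthonormal, Pairwise], by simp [Orthonormal, Pairwise],
      fun i => i.elim0⟩
  | succ n ih =>
    intro E F _ _ _ _ _ _ hE hF S T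
    have : Nontrivial E := Module.nontrivial_of_finrank_pos (R := ℂ) (by omega)
    have : Nontrivial F := Module.nontrivial_of_finrank_pos (R := ℂ) (by omega)
    have : Fact (Module.finrank ℂ E = n + 1) := ⟨hE⟩
    have : Fact (Module.finrank ℂ F = n + 1) := ⟨hF⟩
    obtain ⟨v, hv, w, hw, hS, hT⟩ := exists_ne_zero_mem_span_singleton (hF.trans hE.symm)
      S.adjoint T.adjoint
    have hmap : ∀ L : E →ₗ[ℂ] F, L.adjoint v ∈ Submodule.span ℂ {w} →
        ∀ x ∈ (Submodule.span ℂ {w})ᗮ, L x ∈ (Submodule.span ℂ {v})ᗮ := by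
      intro L hL x hx
      rw [Submodule.mem_orthogonal_singleton_iff_inner_right, ← LinearMap.adjoint_inner_left]
      exact hx _ hL
    obtain ⟨b, c, hb, hc, h⟩ := ih _ _ (Submodule.finrank_orthogonal_span_singleton hw)
      (Submodule.finrank_orthogonal_span_singleton hv)
      (S.restrict (hmap S hS)) (T.restrict (hmap T hT))
    refine ⟨_, _, orthonormal_snoc hw hb, orthonormal_snoc hv hc, ?_⟩
    intro i j
    refine Fin.lastCases ?_ (fun j => ?_) j
    · exact fun hij => absurd (Fin.le_last i) hij.not_ge
    refine Fin.lastCases ?_ (fun i => ?_) i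
    · intro _
      have hL : ∀ L : E →ₗ[ℂ] F, L.adjoint v ∈ Submodule.span ℂ {w} →
          inner ℂ v (L (b j : E)) = 0 := fun L hL =>
        Submodule.mem_orthogonal_singleton_iff_inner_right.1 (hmap L hL _ (b j).2)
      simp [hL S hS, hL T hT]
    · intro hij
      simpa using h i j (Fin.castSucc_lt_castSucc_iff.1 hij)

/-- **Generalized Schur decomposition** of a square matrix pencil. -/
theorem exists_unitary_isUpperTriangular {n : ℕ} (A B : Matrix (Fin n) (Fin n) ℂ) :
    ∃ Q ∈ Matrix.unitaryGroup (Fin n) ℂ, ∃ Z ∈ Matrix.unitaryGroup (Fin n) ℂ,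
      (Q * A * Z).IsUpperTriangular ∧ (Q * B * Z).IsUpperTriangular := by
  obtain ⟨b, c, hb, hc, h⟩ := exists_orthonormal_triangular n
    (EuclideanSpace ℂ (Fin n)) (EuclideanSpace ℂ (Fin n)) (by simp) (by simp)
    (Matrix.toEuclideanLin A) (Matrix.toEuclideanLin B)
  have hmul : ∀ (M : Matrix (Fin n) (Fin n) ℂ) (i j : Fin n),
      (Matrix.of (fun i k => star (c i k)) * M * Matrix.of (fun k j => b j k)) i j =
        inner ℂ (c i) (Matrix.toEuclideanLin M (b j)) := by
    intro M i j
    rw [Matrix.mul_assoc, Matrix.mul_apply]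
    simp [PiLp.inner_apply, Matrix.mul_apply, Matrix.mulVec, dotProduct, mul_comm]
  rw [orthonormal_iff_ite] at hb hc
  refine ⟨Matrix.of fun i k => star (c i k), ?_, Matrix.of fun k j => b j k, ?_, ?_, ?_⟩
  · rw [Matrix.mem_unitaryGroup_iff]
    ext i j
    have := hc i j
    simp only [PiLp.inner_apply] at this
    simpa [Matrix.mul_apply, Matrix.one_apply, Matrix.star_apply, mul_comm] using this
  · rw [Matrix.mem_unitaryGroup_iff']
    ext i j
    have := hb i j
    simp only [PiLp.inner_apply] at this
    simpa [Matrix.mul_apply, Matrix.one_apply, Matrix.star_apply, mul_comm] using this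
  · exact fun i j hij => (hmul A i j).trans (h i j hij).1
  · exact fun i j hij => (hmul B i j).trans (h i j hij).2

section Pencil

variable {n : ℕ}

theorem pencilPoly_mul_mul (P : Matrix (Fin n) (Fin n) ℂ × Matrix (Fin n) (Fin n) ℂ)
    (Q Z : Matrix (Fin n) (Fin n) ℂ) :
    pencilPoly (Q * P.1 * Z, Q * P.2 * Z) =
      Polynomial.C Q.det * pencilPoly P * Polynomial.C Z.det := by
  have hdet : ∀ M : Matrix (Fin n) (Fin n) ℂ,
      Polynomial.C M.det = (M.map Polynomial.C).det := fun M => RingHom.map_det _ _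
  rw [pencilPoly, pencilPoly, hdet, hdet, ← Matrix.det_mul, ← Matrix.det_mul]
  simp only [Matrix.map_mul, Matrix.mul_add, Matrix.add_mul, Matrix.mul_smul, Matrix.smul_mul]

theorem SOmega_mul_mul {Ω : Set (OnePoint ℂ)}
    {P : Matrix (Fin n) (Fin n) ℂ × Matrix (Fin n) (Fin n) ℂ} (hP : P ∈ SOmega Ω n)
    {Q Z : Matrix (Fin n) (Fin n) ℂ} (hQ : Q ∈ Matrix.unitaryGroup (Fin n) ℂ)
    (hZ : Z ∈ Matrix.unitaryGroup (Fin n) ℂ) :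
    (Q * P.1 * Z, Q * P.2 * Z) ∈ SOmega Ω n := by
  obtain ⟨h0, hroot, hinf⟩ := hP
  have hQ0 : Q.det ≠ 0 := (Matrix.UnitaryGroup.det_isUnit ⟨Q, hQ⟩).ne_zero
  have hZ0 : Z.det ≠ 0 := (Matrix.UnitaryGroup.det_isUnit ⟨Z, hZ⟩).ne_zero
  refine ⟨?_, fun z hz => hroot z ?_, fun h => hinf ?_⟩
  · simp [pencilPoly_mul_mul, h0, hQ0, hZ0]
  · simpa [pencilPoly_mul_mul, hQ0, hZ0] using hz
  · simpa [hQ0, hZ0] using h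

theorem pencilPoly_of_isUpperTriangular
    {P : Matrix (Fin n) (Fin n) ℂ × Matrix (Fin n) (Fin n) ℂ}
    (h₁ : P.1.IsUpperTriangular) (h₂ : P.2.IsUpperTriangular) :
    pencilPoly P =
      ∏ i, (Polynomial.C (P.1 i i) + Polynomial.X * Polynomial.C (P.2 i i)) := by
  rw [pencilPoly, Matrix.det_of_isUpperTriangular]
  · simp
  · intro i j hij
    have h₁' : P.1 i j = 0 := h₁ hij
    have h₂' : P.2 i j = 0 := h₂ hij
    simp [h₁', h₂']

/-- An upper triangular pencil lies in `S(Ω,n)` iff its diagonal entries lie in `S(Ω,1)`. -/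
theorem mem_SOmega_iff_of_isUpperTriangular {Ω : Set (OnePoint ℂ)}
    {P : Matrix (Fin n) (Fin n) ℂ × Matrix (Fin n) (Fin n) ℂ}
    (h₁ : P.1.IsUpperTriangular) (h₂ : P.2.IsUpperTriangular) :
    P ∈ SOmega Ω n ↔ ∀ i, (P.1 i i, P.2 i i) ∈ SOmega1 Ω := by
  have hne : ∀ a b : ℂ, Polynomial.C a + Polynomial.X * Polynomial.C b = 0 ↔ a = 0 ∧ b = 0 := by
    refine fun a b => ⟨fun h => ?_, fun h => by simp [h.1, h.2]⟩
    have h0 := congrArg (Polynomial.coeff · 0) h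
    have h1 := congrArg (Polynomial.coeff · 1) h
    exact ⟨by simpa using h0, by simpa [Polynomial.coeff_C] using h1⟩
  simp only [SOmega, SOmega1, Set.mem_ofPred_eq, pencilPoly_of_isUpperTriangular h₁ h₂,
    Matrix.det_of_isUpperTriangular h₂, Polynomial.IsRoot.def, Polynomial.eval_prod,
    Finset.prod_eq_zero_iff, Finset.mem_univ, true_and, not_exists,
    Polynomial.eval_add, Polynomial.eval_mul, Polynomial.eval_C, Polynomial.eval_X,
    Ne, Prod.mk.injEq, hne, forall_exists_index]
  constructor
  · rintro ⟨h0, hroot, hinf⟩ i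
    refine ⟨h0 i, fun hb => hroot _ i ?_, hinf i⟩
    field_simp
    ring
  · intro h
    refine ⟨fun i => (h i).1, fun z i hz => ?_, fun i hi => (h i).2.2 hi⟩
    have hb : P.2 i i ≠ 0 := fun hb => (h i).1 ⟨by simpa [hb] using hz, hb⟩
    have hzeq : -P.1 i i / P.2 i i = z := by
      rw [div_eq_iff hb]
      linear_combination -hz
    exact hzeq ▸ (h i).2.1 hb

theorem pencilNorm_sq (P : Matrix (Fin n) (Fin n) ℂ × Matrix (Fin n) (Fin n) ℂ) :
    pencilNorm P ^ 2 = ∑ i, ∑ j, (‖P.1 i j‖ ^ 2 + ‖P.2 i j‖ ^ 2) :=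
  Real.sq_sqrt (by positivity)

theorem distC2_sq (p q : ℂ × ℂ) :
    distC2 p q ^ 2 = ‖p.1 - q.1‖ ^ 2 + ‖p.2 - q.2‖ ^ 2 :=
  Real.sq_sqrt (by positivity)

theorem ofReal_sum_norm_sq_eq_trace (M : Matrix (Fin n) (Fin n) ℂ) :
    ((∑ i, ∑ j, ‖M i j‖ ^ 2 : ℝ) : ℂ) = (M * star M).trace := by
  simp [Matrix.trace, Matrix.mul_apply, Matrix.star_apply, Complex.mul_conj']

theorem sum_norm_sq_unitary_mul_mul (M : Matrix (Fin n) (Fin n) ℂ)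
    {Q Z : Matrix (Fin n) (Fin n) ℂ} (hQ : Q ∈ Matrix.unitaryGroup (Fin n) ℂ)
    (hZ : Z ∈ Matrix.unitaryGroup (Fin n) ℂ) :
    ∑ i, ∑ j, ‖(Q * M * Z) i j‖ ^ 2 = ∑ i, ∑ j, ‖M i j‖ ^ 2 := by
  have key : ((Q * M * Z) * star (Q * M * Z)).trace = (M * star M).trace := by
    rw [Matrix.mem_unitaryGroup_iff] at hZ
    rw [Matrix.mem_unitaryGroup_iff'] at hQ
    calc ((Q * M * Z) * star (Q * M * Z)).trace
        = (Q * (M * (Z * star Z) * star M * star Q)).trace := by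
          simp only [star_mul, Matrix.mul_assoc]
      _ = (M * (Z * star Z) * star M * (star Q * Q)).trace := by
          rw [Matrix.trace_mul_comm, Matrix.mul_assoc _ (star Q)]
      _ = (M * star M).trace := by rw [hZ, hQ, Matrix.mul_one, Matrix.mul_one]
  rw [← ofReal_sum_norm_sq_eq_trace, ← ofReal_sum_norm_sq_eq_trace] at key
  exact_mod_cast key

theorem pencilNorm_unitary_mul_mul (P : Matrix (Fin n) (Fin n) ℂ × Matrix (Fin n) (Fin n) ℂ)
    {Q Z : Matrix (Fin n) (Fin n) ℂ} (hQ : Q ∈ Matrix.unitaryGroup (Fin n) ℂ)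
    (hZ : Z ∈ Matrix.unitaryGroup (Fin n) ℂ) :
    pencilNorm (Q * P.1 * Z, Q * P.2 * Z) = pencilNorm P := by
  simp only [pencilNorm, Finset.sum_add_distrib, sum_norm_sq_unitary_mul_mul _ hQ hZ]

theorem continuous_pencilNorm :
    Continuous (pencilNorm : Matrix (Fin n) (Fin n) ℂ × Matrix (Fin n) (Fin n) ℂ → ℝ) := by
  unfold pencilNorm
  fun_prop

/-- `T(P)` is a limit of upper triangular pencils in `S(Ω,n)`. -/
theorem Tproj_mem_closure_SOmega {Ω : Set (OnePoint ℂ)} {pΩ : ℂ × ℂ → ℂ × ℂ}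
    (hmem : ∀ p, pΩ p ∈ closure (SOmega1 Ω))
    (P : Matrix (Fin n) (Fin n) ℂ × Matrix (Fin n) (Fin n) ℂ) :
    Tproj pΩ P ∈ closure (SOmega Ω n) := by
  let g : (Fin n → ℂ × ℂ) → Matrix (Fin n) (Fin n) ℂ × Matrix (Fin n) (Fin n) ℂ := fun d =>
    (Matrix.of fun i j => if i < j then P.1 i j else if i = j then (d i).1 else 0,
     Matrix.of fun i j => if i < j then P.2 i j else if i = j then (d i).2 else 0)
  have hg : Continuous g := by
    refine Continuous.prodMk ?_ ?_ <;>
    · refine continuous_matrix fun i j => ?_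
      simp only [Matrix.of_apply]
      split_ifs <;> fun_prop
  have hmaps : Set.MapsTo g (Set.univ.pi fun _ => SOmega1 Ω) (SOmega Ω n) := by
    intro d hd
    refine (mem_SOmega_iff_of_isUpperTriangular ?_ ?_).2 fun i => ?_
    · intro i j (hij : j < i)
      simp [g, hij.not_gt, hij.ne']
    · intro i j (hij : j < i)
      simp [g, hij.not_gt, hij.ne']
    · simpa [g] using hd i (Set.mem_univ i)
  have hd : (fun i => pΩ (P.1 i i, P.2 i i)) ∈ closure (Set.univ.pi fun _ => SOmega1 Ω) := by
    rw [closure_pi_set]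
    exact fun i _ => hmem _
  exact hmaps.closure hg hd

/-- `T(P)` is at least as close to `P` as any upper triangular pencil of `S(Ω,n)`. -/
theorem pencilNorm_sub_Tproj_sq_le {Ω : Set (OnePoint ℂ)} {pΩ : ℂ × ℂ → ℂ × ℂ}
    (hdist : ∀ p : ℂ × ℂ, ∀ q ∈ closure (SOmega1 Ω), distC2 p (pΩ p) ≤ distC2 p q)
    (P : Matrix (Fin n) (Fin n) ℂ × Matrix (Fin n) (Fin n) ℂ)
    {R : Matrix (Fin n) (Fin n) ℂ × Matrix (Fin n) (Fin n) ℂ} (hR : R ∈ SOmega Ω n)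
    (h₁ : R.1.IsUpperTriangular) (h₂ : R.2.IsUpperTriangular) :
    pencilNorm (P - Tproj pΩ P) ^ 2 ≤ pencilNorm (P - R) ^ 2 := by
  rw [pencilNorm_sq, pencilNorm_sq]
  refine Finset.sum_le_sum fun i _ => Finset.sum_le_sum fun j _ => ?_
  rcases lt_trichotomy i j with hij | rfl | hij
  · refine le_of_eq_of_le (b := 0) ?_ (by positivity)
    simp [Tproj, hij]
  · have h := hdist (P.1 i i, P.2 i i) (R.1 i i, R.2 i i)
      (subset_closure ((mem_SOmega_iff_of_isUpperTriangular h₁ h₂).1 hR i))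
    have h' := pow_le_pow_left₀ (Real.sqrt_nonneg _) h 2
    rw [← distC2, distC2_sq, distC2_sq] at h'
    simpa [Tproj] using h'
  · have h₁' : R.1 i j = 0 := h₁ hij
    have h₂' : R.2 i j = 0 := h₂ hij
    simp [Tproj, hij.not_gt, hij.ne', h₁', h₂']

end Pencil

/-- the squared distance from `(A,B)` to the closure of `S(Ω,n)` equals the
infimum over unitary pairs `(Q,Z)` of `f(Q,Z) = ‖(QAZ,QBZ) − T(QAZ,QBZ)‖²`. -/
theorem sq_distance_eq_inf_over_unitary {n : ℕ} (Ω : Set (OnePoint ℂ))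
    (hclosed : IsClosed Ω) (hne : Ω.Nonempty)
    (pΩ : ℂ × ℂ → ℂ × ℂ)
    (hmem : ∀ p : ℂ × ℂ, pΩ p ∈ closure (SOmega1 Ω))
    (hdist : ∀ p : ℂ × ℂ, ∀ q ∈ closure (SOmega1 Ω), distC2 p (pΩ p) ≤ distC2 p q)
    (A B : Matrix (Fin n) (Fin n) ℂ) :
    sInf {r : ℝ | ∃ P ∈ closure (SOmega Ω n), r = pencilNorm ((A, B) - P) ^ 2} =
    sInf {r : ℝ | ∃ Q ∈ Matrix.unitaryGroup (Fin n) ℂ, ∃ Z ∈ Matrix.unitaryGroup (Fin n) ℂ,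
      r = pencilNorm ((Q * A * Z, Q * B * Z) - Tproj pΩ (Q * A * Z, Q * B * Z)) ^ 2} := by
  set L : Set ℝ := {r : ℝ | ∃ P ∈ closure (SOmega Ω n), r = pencilNorm ((A, B) - P) ^ 2} with hL
  set R : Set ℝ := {r : ℝ | ∃ Q ∈ Matrix.unitaryGroup (Fin n) ℂ,
    ∃ Z ∈ Matrix.unitaryGroup (Fin n) ℂ,
      r = pencilNorm ((Q * A * Z, Q * B * Z) - Tproj pΩ (Q * A * Z, Q * B * Z)) ^ 2} with hR
  have hLbdd : BddBelow L := ⟨0, by rintro _ ⟨P, -, rfl⟩; positivity⟩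
  have hRbdd : BddBelow R := ⟨0, by rintro _ ⟨Q, -, Z, -, rfl⟩; positivity⟩
  have hRne : R.Nonempty := ⟨_, 1, one_mem _, 1, one_mem _, rfl⟩
  have hRL : R ⊆ L := by
    rintro _ ⟨Q, hQ, Z, hZ, rfl⟩
    set T := Tproj pΩ (Q * A * Z, Q * B * Z) with hT
    have hQ' := Unitary.star_mem hQ
    have hZ' := Unitary.star_mem hZ
    have hmaps : Set.MapsTo (fun P : Matrix (Fin n) (Fin n) ℂ × Matrix (Fin n) (Fin n) ℂ =>
        (star Q * P.1 * star Z, star Q * P.2 * star Z)) (SOmega Ω n) (SOmega Ω n) :=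
      fun P hP => SOmega_mul_mul hP hQ' hZ'
    refine ⟨_, hmaps.closure (by fun_prop) (Tproj_mem_closure_SOmega hmem (Q * A * Z, Q * B * Z)),
      ?_⟩
    rw [← pencilNorm_unitary_mul_mul _ hQ' hZ']
    have hcancel : ∀ M : Matrix (Fin n) (Fin n) ℂ, star Q * (Q * M * Z) * star Z = M := by
      intro M
      rw [Matrix.mem_unitaryGroup_iff] at hZ
      rw [Matrix.mem_unitaryGroup_iff'] at hQ
      rw [Matrix.mul_assoc, Matrix.mul_assoc, Matrix.mul_assoc, hZ, ← Matrix.mul_assoc, hQ,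
        Matrix.mul_one, Matrix.one_mul]
    simp only [Prod.fst_sub, Prod.snd_sub, Matrix.mul_sub, Matrix.sub_mul, hcancel,
      Prod.mk_sub_mk, ← hT]
  refine le_antisymm (csInf_le_csInf hLbdd hRne hRL) (le_csInf (hRne.mono hRL) ?_)
  rintro _ ⟨P, hP, rfl⟩
  have hcl : IsClosed {P | sInf R ≤ pencilNorm ((A, B) - P) ^ 2} :=
    isClosed_le continuous_const
      ((continuous_pencilNorm.comp (continuous_const.sub continuous_id)).pow 2)
  refine closure_minimal (fun P hP => ?_) hcl hP
  obtain ⟨Q, hQ, Z, hZ, h₁, h₂⟩ := exists_unitary_isUpperTriangular P.1 P.2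
  refine (csInf_le hRbdd ⟨Q, hQ, Z, hZ, rfl⟩).trans
    ((pencilNorm_sub_Tproj_sq_le hdist _ (SOmega_mul_mul hP hQ hZ) h₁ h₂).trans_eq ?_)
  rw [← pencilNorm_unitary_mul_mul ((A, B) - P) hQ hZ]
  simp [Matrix.mul_sub, Matrix.sub_mul]
end

section
/- Let Ω_H = {z ∈ ℂ : Re z ≤ 0} ∪ {∞} and n ≥ 2. Let (A,B) be a regular n×n pencil whose eigenvalues all belong to Ω_H but whose index is at least 2, i.e. the multiplicity of 0 as a root of det(B + X·A) is strictly greater than n − rank(B). Then for every ε > 0 there exists a regular pencil (A',B') of index at most 1 with all eigenvalues in Ω_H such that ‖(A − A', B − B')‖ = ε. -/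
open Matrix

/-- `Ω_H`: the closed left half plane together with `∞`. -/
def OmegaH : Set (OnePoint ℂ) :=
  {z | z = (OnePoint.infty : OnePoint ℂ) ∨ ∃ w : ℂ, w.re ≤ 0 ∧ z = (w : OnePoint ℂ)}

theorem eval_pencilPoly {n : ℕ} (A B : Matrix (Fin n) (Fin n) ℂ) (z : ℂ) :
    (pencilPoly (A, B)).eval z = (A + z • B).det := by
  rw [pencilPoly, ← Polynomial.coe_evalRingHom, RingHom.map_det]
  congr 1
  ext i j
  simp
  exact mul_comm _ _

/-- If `P` is regular with spectrum in the closed left half plane, then `A + z B` is invertible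
for `z` in the open right half plane. -/
theorem det_ne_zero_of_mem_SOmega {n : ℕ} {A B : Matrix (Fin n) (Fin n) ℂ}
    (h : (A, B) ∈ SOmega OmegaH n) {z : ℂ} (hz : 0 < z.re) : (A + z • B).det ≠ 0 := by
  intro h0
  rw [← eval_pencilPoly] at h0
  rcases h.2.1 z h0 with h1 | ⟨w, hw, h1⟩
  · exact OnePoint.coe_ne_infty z h1
  · rw [OnePoint.coe_injective h1] at hz
    exact absurd hw (not_le.mpr hz)

/-- The shift `B ↦ B + t A` with `t > 0` keeps `A + z B` invertible on the open right half
plane. -/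
theorem det_shift_ne_zero {n : ℕ} {A B : Matrix (Fin n) (Fin n) ℂ}
    (h : (A, B) ∈ SOmega OmegaH n) {t : ℝ} (ht : 0 < t) {z : ℂ} (hz : 0 < z.re) :
    (A + z • (B + (t : ℂ) • A)).det ≠ 0 := by
  have hre : 0 < (1 + t * z).re := by
    simp only [Complex.add_re, Complex.one_re, Complex.re_ofReal_mul]
    positivity
  have hne : (1 + t * z) ≠ 0 := fun h0 => by simp [h0] at hre
  have hu : 0 < (z / (1 + t * z)).re := by
    have hsq : 0 < Complex.normSq (1 + t * z) := Complex.normSq_pos.mpr hne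
    rw [Complex.div_re, ← add_div]
    refine div_pos ?_ hsq
    simp only [Complex.add_re, Complex.one_re, Complex.re_ofReal_mul, Complex.add_im,
      Complex.one_im, Complex.im_ofReal_mul]
    nlinarith [mul_nonneg ht.le (sq_nonneg z.im), mul_pos ht (pow_pos hz 2)]
  have heq : A + z • (B + (t : ℂ) • A) = (1 + t * z) • (A + (z / (1 + t * z)) • B) := by
    rw [smul_add (1 + t * z), smul_smul (1 + t * z), mul_div_cancel₀ _ hne]
    module
  rw [heq, det_smul]
  exact mul_ne_zero (pow_ne_zero _ hne) (det_ne_zero_of_mem_SOmega h hu)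

/-- The shift `B ↦ B + t A` with `t > 0` makes the second coefficient invertible. -/
theorem det_add_smul_ne_zero {n : ℕ} {A B : Matrix (Fin n) (Fin n) ℂ}
    (h : (A, B) ∈ SOmega OmegaH n) {t : ℝ} (ht : 0 < t) : (B + (t : ℂ) • A).det ≠ 0 := by
  have htc : (t : ℂ) ≠ 0 := by exact_mod_cast ht.ne'
  have heq : B + (t : ℂ) • A = (t : ℂ) • (A + ((t⁻¹ : ℝ) : ℂ) • B) := by
    rw [smul_add, smul_smul, Complex.ofReal_inv, mul_inv_cancel₀ htc, one_smul, add_comm]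
  rw [heq, det_smul]
  refine mul_ne_zero (pow_ne_zero _ htc) (det_ne_zero_of_mem_SOmega h ?_)
  rw [Complex.ofReal_re]
  positivity

theorem shift_mem_SOmega {n : ℕ} {A B : Matrix (Fin n) (Fin n) ℂ}
    (h : (A, B) ∈ SOmega OmegaH n) {t : ℝ} (ht : 0 < t) :
    (A, B + (t : ℂ) • A) ∈ SOmega OmegaH n := by
  refine ⟨fun h0 => ?_, fun z hz => ?_, fun _ => Or.inl rfl⟩
  · apply det_shift_ne_zero h ht (z := 1) (by simp)
    rw [← eval_pencilPoly, h0, Polynomial.eval_zero]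
  · refine Or.inr ⟨z, ?_, rfl⟩
    by_contra! hre
    rw [Polynomial.IsRoot, eval_pencilPoly] at hz
    exact det_shift_ne_zero h ht hre hz

theorem rootMultiplicity_zero_pencilPoly {n : ℕ} {A B : Matrix (Fin n) (Fin n) ℂ}
    (hB : B.det ≠ 0) : (pencilPoly (B, A)).rootMultiplicity 0 = 0 := by
  apply Polynomial.rootMultiplicity_eq_zero
  rwa [Polynomial.IsRoot, eval_pencilPoly, zero_smul, add_zero]

theorem pencilNorm_zero_smul {n : ℕ} (A : Matrix (Fin n) (Fin n) ℂ) {t : ℝ} (ht : 0 ≤ t) :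
    pencilNorm (0, (t : ℂ) • A) = t * pencilNorm (0, A) := by
  simp [pencilNorm, mul_pow, ← Finset.mul_sum, Real.sqrt_mul, Real.sqrt_sq ht, sq_nonneg]

theorem pencilNorm_zero_neg {n : ℕ} (B : Matrix (Fin n) (Fin n) ℂ) :
    pencilNorm (0, -B) = pencilNorm (0, B) := by
  simp [pencilNorm]

theorem pencilNorm_zero_left_pos {n : ℕ} {A : Matrix (Fin n) (Fin n) ℂ} (hA : A ≠ 0) :
    0 < pencilNorm (0, A) := by
  obtain ⟨i, j, hij⟩ : ∃ i j, A i j ≠ 0 := by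
    by_contra! h
    exact hA (Matrix.ext h)
  refine Real.sqrt_pos.mpr (Finset.sum_pos' (fun _ _ => by positivity) ⟨i, Finset.mem_univ i, ?_⟩)
  refine Finset.sum_pos' (fun _ _ => by positivity) ⟨j, Finset.mem_univ j, ?_⟩
  have : 0 < ‖A i j‖ := norm_pos_iff.mpr hij
  positivity

/-- if `(A,B)` is a regular pencil with all eigenvalues in `Ω_H` but of
index at least 2 (the multiplicity of `0` as a root of `det(B + X·A)` exceeds
`n − rank B`), then for every `ε > 0` there is a regular pencil `(A',B')` of index at
most 1 with all eigenvalues in `Ω_H` and with `‖(A − A', B − B')‖ = ε`. -/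
theorem perturb_to_index_at_most_one {n : ℕ} (hn : 2 ≤ n)
    (A B : Matrix (Fin n) (Fin n) ℂ)
    (hstab : (A, B) ∈ SOmega OmegaH n)
    (hindex : n - B.rank < (pencilPoly (B, A)).rootMultiplicity 0) :
    ∀ ε : ℝ, 0 < ε → ∃ A' B' : Matrix (Fin n) (Fin n) ℂ,
      (A', B') ∈ SOmega OmegaH n ∧
      (pencilPoly (B', A')).rootMultiplicity 0 = n - B'.rank ∧
      pencilNorm (A - A', B - B') = ε := by
  intro ε hε
  have hA : A ≠ 0 := by
    rintro rfl
    have hB : pencilPoly (B, (0 : Matrix (Fin n) (Fin n) ℂ)) = Polynomial.C B.det := by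
      rw [pencilPoly, RingHom.map_det]
      congr 1
      ext i j
      simp
    rw [hB, Polynomial.rootMultiplicity_C] at hindex
    exact absurd hindex (Nat.not_lt_zero _)
  have hpos := pencilNorm_zero_left_pos hA
  have ht : 0 < ε / pencilNorm (0, A) := div_pos hε hpos
  have hdet := det_add_smul_ne_zero hstab ht
  refine ⟨A, _, shift_mem_SOmega hstab ht, ?_, ?_⟩
  · rw [rootMultiplicity_zero_pencilPoly hdet, rank_of_isUnit _
      ((isUnit_iff_isUnit_det _).mpr hdet.isUnit), Fintype.card_fin, Nat.sub_self]
  · rw [sub_self, sub_add_cancel_left, pencilNorm_zero_neg, pencilNorm_zero_smul A ht.le, div_mul_cancel₀ _ hpos.ne']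
end
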